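/- arXiv:2501.05388 — 3 statements merged into one kernel-verified Lean document; each statement's English description precedes it below -/
import Mathlib

section
/- Gap propagation (Proposition 1). Let S be a nonempty finite scenario set, X a nonempty set of first-stage solutions, f : X → ℝ a first-stage cost with f(x) ≥ 0 for all x, and Q : X × S → ℝ a second-stage cost with Q(x,s) ≥ 0 for all x, s. Let P ∈ [0,1), let D ⊆ S, and suppose (x̃, z̃) is a master solution of MAS_D with gap P, i.e., z̃ ≥ 0, Q(x̃,s) ≤ z̃ for all s ∈ D, and f(x̃) + z̃ ≤ (1/(1−P))·OPT_D. If Q(x̃,s) ≤ z̃ for all s ∈ S, then f(x̃) + max_{s∈S} Q(x̃,s) ≤ (1/(1−P))·OPT_S, i.e., the first-stage solution x̃ is a solution of the two-stage robust problem with gap P. -/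
open Finset

/-- Maximum of the second-stage costs over a finite scenario subset,
with the maximum over the empty set defined as `0`. -/
noncomputable def masterMax {X σ : Type*} (Q : X → σ → ℝ) (D : Finset σ) (x : X) : ℝ :=
  if h : D.Nonempty then D.sup' h (Q x) else 0

/-- Optimal value of the master problem `MAS_D`. -/
noncomputable def OPT {X σ : Type*} (f : X → ℝ) (Q : X → σ → ℝ) (D : Finset σ) : ℝ :=
  ⨅ x : X, (f x + masterMax Q D x)

theorem masterMax_nonneg {X σ : Type*} {Q : X → σ → ℝ} (hQ : ∀ x s, 0 ≤ Q x s)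
    (D : Finset σ) (x : X) : 0 ≤ masterMax Q D x := by
  unfold masterMax
  split_ifs with h
  · obtain ⟨s, hs⟩ := h
    exact (hQ x s).trans (Finset.le_sup' (Q x) hs)
  · exact le_rfl

theorem masterMax_mono {X σ : Type*} {Q : X → σ → ℝ} (hQ : ∀ x s, 0 ≤ Q x s)
    {D S : Finset σ} (hD : D ⊆ S) (x : X) : masterMax Q D x ≤ masterMax Q S x := by
  by_cases h : D.Nonempty
  · rw [masterMax, masterMax, dif_pos h, dif_pos (h.mono hD)]
    exact Finset.sup'_mono (Q x) hD h
  · rw [masterMax, dif_neg h]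
    exact masterMax_nonneg hQ S x

theorem OPT_mono {X σ : Type*} {f : X → ℝ} {Q : X → σ → ℝ}
    (hf : ∀ x, 0 ≤ f x) (hQ : ∀ x s, 0 ≤ Q x s) {D S : Finset σ} (hD : D ⊆ S) :
    OPT f Q D ≤ OPT f Q S := by
  refine ciInf_mono ⟨0, ?_⟩ fun x => by gcongr; exact masterMax_mono hQ hD x
  rintro _ ⟨x, rfl⟩
  exact add_nonneg (hf x) (masterMax_nonneg hQ D x)

/-- Proposition 1 (gap propagation). -/
theorem gap_propagation {X σ : Type*} [Nonempty X]
    (S : Finset σ) (hS : S.Nonempty)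
    (f : X → ℝ) (Q : X → σ → ℝ)
    (hf : ∀ x, 0 ≤ f x) (hQ : ∀ x s, 0 ≤ Q x s)
    (P : ℝ) (hP0 : 0 ≤ P) (hP1 : P < 1)
    (D : Finset σ) (hD : D ⊆ S)
    (xt : X) (zt : ℝ) (hzt : 0 ≤ zt)
    (hmaster : ∀ s ∈ D, Q xt s ≤ zt)
    (hgap : f xt + zt ≤ (1 / (1 - P)) * OPT f Q D)
    (hall : ∀ s ∈ S, Q xt s ≤ zt) :
    f xt + S.sup' hS (Q xt) ≤ (1 / (1 - P)) * OPT f Q S := by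
  have hP : 0 ≤ 1 / (1 - P) := one_div_nonneg.2 (sub_nonneg.2 hP1.le)
  calc f xt + S.sup' hS (Q xt) ≤ f xt + zt := by gcongr; exact Finset.sup'_le hS _ hall
    _ ≤ 1 / (1 - P) * OPT f Q D := hgap
    _ ≤ 1 / (1 - P) * OPT f Q S :=
      mul_le_mul_of_nonneg_left (OPT_mono hf hQ hD) hP
end

section
/- Lemma 2(2) (abstracted). Let S be a nonempty finite scenario set, X a nonempty set of first-stage solutions, and Q : X × S → ℝ with Q(x,s) ≥ 0. Let D ⊆ S, let x̃ ∈ X, and let z̃, z' ∈ ℝ with z̃ ≤ z' and Q(x̃,s) ≤ z̃ for all s ∈ D. Suppose there are functions UB, LB : S → ℝ such that for every s ∈ S \ D: Q(x̃,s) ≤ UB(s), LB(s) ≤ UB(s), and either UB(s) ≤ z' or there exists r ∈ S \ D with LB(r) > UB(s). Then Q(x̃,s) ≤ z' for all s ∈ S. -/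
open Finset

/-- Lemma 2(2), abstracted. -/
theorem lemma_two_two {X σ : Type*} [Nonempty X] [DecidableEq σ]
    (S : Finset σ) (hS : S.Nonempty)
    (Q : X → σ → ℝ) (hQ : ∀ x s, 0 ≤ Q x s)
    (D : Finset σ) (hD : D ⊆ S)
    (xt : X) (zt z' : ℝ) (hzz' : zt ≤ z')
    (hmaster : ∀ s ∈ D, Q xt s ≤ zt)
    (UB LB : σ → ℝ)
    (hQUB : ∀ s ∈ S \ D, Q xt s ≤ UB s)
    (hLBUB : ∀ s ∈ S \ D, LB s ≤ UB s)
    (hexcl : ∀ s ∈ S \ D, UB s ≤ z' ∨ ∃ r ∈ S \ D, LB r > UB s) :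
    ∀ s ∈ S, Q xt s ≤ z' := by
  intro s hs
  by_cases hsD : s ∈ D
  · exact (hmaster s hsD).trans hzz'
  have hs' : s ∈ S \ D := mem_sdiff.mpr ⟨hs, hsD⟩
  obtain ⟨m, hm, hmax⟩ := exists_max_image (S \ D) UB ⟨s, hs'⟩
  have hmz : UB m ≤ z' := by
    refine (hexcl m hm).resolve_right ?_
    rintro ⟨r, hr, hlt⟩
    exact absurd ((hLBUB r hr).trans (hmax r hr)) (not_le.mpr hlt)
  exact (hQUB s hs').trans ((hmax s hs').trans hmz)
end

section
/- Correctness of the approximate scenario bracketing procedure upon termination (Theorem 1, abstracted). Let S be a nonempty finite scenario set, X a nonempty set of first-stage solutions, f : X → ℝ with f(x) ≥ 0, and Q : X × S → ℝ with Q(x,s) ≥ 0. Let 0 ≤ p ≤ P < 1, let D ⊆ S, and suppose (x̃, z̃) is a master solution of MAS_D with gap p, i.e., z̃ ≥ 0, Q(x̃,s) ≤ z̃ for all s ∈ D, and f(x̃) + z̃ ≤ (1/(1−p))·OPT_D. Set z' := ((1−p)/(1−P))·z̃ + ((P−p)/(1−P))·f(x̃). Suppose there are functions UB, LB : S → ℝ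 such that for every s ∈ S \ D: Q(x̃,s) ≤ UB(s), LB(s) ≤ UB(s), and either UB(s) ≤ z' or there exists r ∈ S \ D with LB(r) > UB(s). Then f(x̃) + max_{s∈S} Q(x̃,s) ≤ (1/(1−P))·OPT_S, i.e., x̃ is a solution of the two-stage robust problem with gap at most P. -/
open Finset

/-- If every element whose upper bound exceeds `c` is dominated by the lower bound of another
element, then no upper bound exceeds `c`. -/
theorem upper_le_of_le_or_dominated {σ : Type*} {T : Finset σ} {UB LB : σ → ℝ} {c : ℝ}
    (hLBUB : ∀ s ∈ T, LB s ≤ UB s)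
    (hexcl : ∀ s ∈ T, UB s ≤ c ∨ ∃ r ∈ T, LB r > UB s) : ∀ s ∈ T, UB s ≤ c := by
  intro s hs
  obtain ⟨m, hm, hmax⟩ := exists_max_image T UB ⟨s, hs⟩
  rcases hexcl m hm with h | ⟨r, hr, hlt⟩
  · exact (hmax s hs).trans h
  · linarith [hLBUB r hr, hmax r hr]

/-- Correctness of the approximate scenario bracketing procedure upon termination
(Theorem 1, abstracted). -/
theorem asbp_correctness {X σ : Type*} [Nonempty X] [DecidableEq σ]
    (S : Finset σ) (hS : S.Nonempty)
    (f : X → ℝ) (Q : X → σ → ℝ)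
    (hf : ∀ x, 0 ≤ f x) (hQ : ∀ x s, 0 ≤ Q x s)
    (p P : ℝ) (hp0 : 0 ≤ p) (hpP : p ≤ P) (hP1 : P < 1)
    (D : Finset σ) (hD : D ⊆ S)
    (xt : X) (zt : ℝ) (hzt : 0 ≤ zt)
    (hmaster : ∀ s ∈ D, Q xt s ≤ zt)
    (hgap : f xt + zt ≤ (1 / (1 - p)) * OPT f Q D)
    (z' : ℝ) (hz' : z' = ((1 - p) / (1 - P)) * zt + ((P - p) / (1 - P)) * f xt)
    (UB LB : σ → ℝ)
    (hQUB : ∀ s ∈ S \ D, Q xt s ≤ UB s)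
    (hLBUB : ∀ s ∈ S \ D, LB s ≤ UB s)
    (hexcl : ∀ s ∈ S \ D, UB s ≤ z' ∨ ∃ r ∈ S \ D, LB r > UB s) :
    f xt + S.sup' hS (Q xt) ≤ (1 / (1 - P)) * OPT f Q S := by
  have hP : 0 < 1 - P := by linarith
  have hp : 0 < 1 - p := by linarith
  have hUB := upper_le_of_le_or_dominated hLBUB hexcl
  have hz : zt ≤ z' := by
    have hdiff : z' - zt = (P - p) * (zt + f xt) / (1 - P) := by
      rw [hz']; field_simp; ring
    have : 0 ≤ (P - p) * (zt + f xt) / (1 - P) :=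
      div_nonneg (mul_nonneg (by linarith) (add_nonneg hzt (hf xt))) hP.le
    linarith
  have hsup : S.sup' hS (Q xt) ≤ z' := by
    refine sup'_le hS _ fun s hs => ?_
    by_cases hsD : s ∈ D
    · exact (hmaster s hsD).trans hz
    · have hs' := mem_sdiff.mpr ⟨hs, hsD⟩
      exact (hQUB s hs').trans (hUB s hs')
  have hgap' : (1 - p) * (f xt + zt) ≤ OPT f Q D := by
    rwa [one_div, ← div_eq_inv_mul, le_div_iff₀' hp] at hgap
  calc f xt + S.sup' hS (Q xt) ≤ f xt + z' := by gcongr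
    _ = (1 / (1 - P)) * ((1 - p) * (f xt + zt)) := by rw [hz']; field_simp; ring
    _ ≤ (1 / (1 - P)) * OPT f Q S := by
      gcongr
      exact hgap'.trans (OPT_mono hf hQ hD)
end
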